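/- Let b > 1 and r > 1. The sequence (δ_{x_n}^{p_n})_{n∈ℕ}, with x_{n,j} = (1 + (j/(n+1))(b^{r/(r+1)} − 1))^{1+1/r} and P_{n,j} = (1/log b) · log((x_{n,j} + x_{n,j+1})/2) for j = 1,…,n−1, and x_{n,n} = (1 + (n/(n+1))(b^{r/(r+1)} − 1))^{1+1/r}, is a sequence of asymptotically best d_r-approximations of the Benford measure β_b; that is, lim_{n→∞} d_r(β_b, δ_{x_n}^{p_n}) / min_{y∈Ξ_n, q∈Π_n} d_r(β_b, δ_y^q) = 1. Moreover, lim_{n→∞} n · min_{y∈Ξ_n, q∈Π_n} d_r(β_b, δ_y^q) = (r+1)/(2(b−1)(log b)^{1/r}) · ((b^{r/(r+1)} − 1)/r)^{1+1/r}. -/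

import Mathlib

open MeasureTheory Filter Set

noncomputable section

namespace BenfordApprox

/-- Right-hand limit `f₊` of a nondecreasing `f : ℝ → ℝ̄`, at an extended-real point. -/
def fplus (f : ℝ → EReal) (a : EReal) : EReal := sInf (f '' {x : ℝ | a < (x : EReal)})

/-- Left-hand limit `f₋` of a nondecreasing `f : ℝ → ℝ̄`, at an extended-real point. -/
def fminus (f : ℝ → EReal) (a : EReal) : EReal := sSup (f '' {x : ℝ | (x : EReal) < a})

/-- The (upper) inverse function `f⁻¹(t) = sup {x : f x ≤ t}` (with `sup ∅ = ⊥`). -/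
def upperInv (f : ℝ → EReal) (t : ℝ) : EReal :=
  sSup ((fun x : ℝ => (x : EReal)) '' {x : ℝ | f x ≤ (t : EReal)})

/-- The upper inverse, for an extended-real argument. -/
def upperInvE (f : ℝ → EReal) (t : EReal) : EReal :=
  sSup ((fun x : ℝ => (x : EReal)) '' {x : ℝ | f x ≤ t})

/-- Lévy-type distance `d_L(f,g)` between nondecreasing functions `f g : ℝ → ℝ̄`. -/
def dLfun (f g : ℝ → EReal) : EReal :=
  sInf ((fun y : ℝ => (y : EReal)) ''
    {y : ℝ | 0 ≤ y ∧ ∀ x : ℝ, f (x - y) - (y : EReal) ≤ g x ∧ g x ≤ f (x + y) + (y : EReal)})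

/-- The auxiliary function `ℓ_{f,I}`; it depends on `I` only through `lo = inf I`, `hi = sup I`. -/
def ell (f : ℝ → EReal) (lo hi : EReal) (x : ℝ) : ℝ :=
  sInf {y : ℝ | 0 ≤ y ∧ fminus f (hi - (y : EReal)) - (y : EReal) ≤ (x : EReal) ∧
    (x : EReal) ≤ fplus f (lo + (y : EReal)) + (y : EReal)}

/-- The minimal value `ℓ*_{f,I} = min {y ≥ 0 : f₋(sup I − y) − y ≤ f₊(inf I + y) + y}`. -/
def ellStar (f : ℝ → EReal) (lo hi : EReal) : ℝ :=
  sInf {y : ℝ | 0 ≤ y ∧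
    fminus f (hi - (y : EReal)) - (y : EReal) ≤ fplus f (lo + (y : EReal)) + (y : EReal)}

/-- Distribution function `F_μ(t) = μ {y ∈ 𝕀 : y ≤ t}` of `μ`, where `𝕀 = [A,B]`. -/
def cdf (μ : Measure ℝ) (A B : ℝ) (t : ℝ) : ℝ := (μ (Icc A B ∩ Iic t)).toReal

/-- `F_μ` evaluated at an extended-real point (so `F_μ(−∞) = 0`, `F_μ(+∞) = 1`). -/
def cdfE (μ : Measure ℝ) (A B : ℝ) (a : EReal) : ℝ :=
  (μ (Icc A B ∩ {y : ℝ | (y : EReal) ≤ a})).toReal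

/-- Left limit `F_{μ−}` at an extended-real point (so `F_{μ−}(−∞) = 0`, `F_{μ−}(+∞) = 1`). -/
def cdfL (μ : Measure ℝ) (A B : ℝ) (a : EReal) : ℝ :=
  sSup ((cdf μ A B) '' {t : ℝ | (t : EReal) < a})

/-- Left limit `F_{μ−}` at a real point. -/
def cdfm (μ : Measure ℝ) (A B : ℝ) (t : ℝ) : ℝ := sSup ((cdf μ A B) '' Iio t)

/-- The (upper) quantile function `F_μ⁻¹` of `μ` on `𝕀 = [A,B]`, extended monotonically to `ℝ`. -/
def quant (μ : Measure ℝ) (A B : ℝ) (t : ℝ) : ℝ :=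
  if t < (μ {A}).toReal ∨ t < 0 then A
  else sSup {y ∈ Icc A B | cdf μ A B y ≤ t}

/-- Left limit `F⁻¹_{μ−}` of the quantile function. -/
def quantm (μ : Measure ℝ) (A B : ℝ) (t : ℝ) : ℝ := sSup ((quant μ A B) '' Iio t)

/-- `F_μ` as a function into the extended reals. -/
def cdfEReal (μ : Measure ℝ) (A B : ℝ) : ℝ → EReal := fun t => ((cdf μ A B t : ℝ) : EReal)

/-- `F_μ⁻¹` as a function into the extended reals. -/
def quantEReal (μ : Measure ℝ) (A B : ℝ) : ℝ → EReal := fun t => ((quant μ A B t : ℝ) : EReal)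

/-- The finitely supported measure `δ_x^p = Σ_j p_j δ_{x_j}`. -/
def discr (n : ℕ) (x p : Fin n → ℝ) : Measure ℝ :=
  ∑ j : Fin n, ENNReal.ofReal (p j) • Measure.dirac (x j)

/-- `p ∈ Π_n`: a probability vector. -/
def IsPi (n : ℕ) (p : Fin n → ℝ) : Prop := (∀ j, 0 ≤ p j) ∧ ∑ j, p j = 1

/-- `x ∈ Ξ_n`: a nondecreasing vector of locations in `𝕀 = [A,B]`. -/
def IsXi (A B : ℝ) (n : ℕ) (x : Fin n → ℝ) : Prop := (∀ j, x j ∈ Icc A B) ∧ Monotone x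

/-- The uniform weight vector `u_n = (1/n, …, 1/n)`. -/
def unif (n : ℕ) : Fin n → ℝ := fun _ => 1 / (n : ℝ)

/-- Partial sums `P_i = Σ_{j<i} p_j` (so `P_0 = 0`, `P_n = 1`). -/
def psum (n : ℕ) (p : Fin n → ℝ) (i : ℕ) : ℝ := ∑ j : Fin n, if (j : ℕ) < i then p j else 0

/-- Locations extended by `x_0 = −∞`, `x_{n+1} = +∞`; here `extPts n x j` is the paper's `x_j`. -/
def extPts (n : ℕ) (x : Fin n → ℝ) : ℕ → EReal := fun j =>
  if hj : j = 0 then ⊥ else if h : j ≤ n then ((x ⟨j - 1, by omega⟩ : ℝ) : EReal) else ⊤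

/-- `xcoord n x j` is the paper's `x_{j+1}` (0-based access). -/
def xcoord (n : ℕ) (x : Fin n → ℝ) (j : ℕ) : ℝ := if h : j < n then x ⟨j, h⟩ else 0

/-- The normalizing constant `ω = max{1, λ(𝕀)}/λ(𝕀)` for `𝕀 = [A,B]`. -/
def omegaI (A B : ℝ) : ℝ := max 1 (B - A) / (B - A)

/-- Lévy distance between Borel measures on `𝕀 = [A,B]`. -/
def dLevy (A B : ℝ) (μ ν : Measure ℝ) : ℝ :=
  omegaI A B * sInf {y : ℝ | 0 ≤ y ∧
    ∀ t : ℝ, cdf μ A B (t - y) - y ≤ cdf ν A B t ∧ cdf ν A B t ≤ cdf μ A B (t + y) + y}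

/-- Kolmogorov (uniform) distance between Borel measures on `𝕀 = [A,B]`. -/
def dKol (A B : ℝ) (μ ν : Measure ℝ) : ℝ :=
  sSup (Set.range fun t : ℝ => |cdf μ A B t - cdf ν A B t|)

/-- `L¹`-Kantorovich distance between Borel measures on `𝕀 = [A,B]`. -/
def dKant1 (A B : ℝ) (μ ν : Measure ℝ) : ℝ :=
  (B - A)⁻¹ * ∫ y in Ioo (0 : ℝ) 1, |quant μ A B y - quant ν A B y|

/-- `L^r`-Kantorovich distance between Borel measures on `𝕀 = [A,B]`. -/
def dKant (A B r : ℝ) (μ ν : Measure ℝ) : ℝ :=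
  (B - A)⁻¹ * (∫ y in Ioo (0 : ℝ) 1, |quant μ A B y - quant ν A B y| ^ r) ^ (1 / r)

/-- The Benford measure `β_b` on `[1,b]`: the law of `b^U` with `U` uniform on `[0,1)`. -/
def benford (b : ℝ) : Measure ℝ := (volume.restrict (Ico (0 : ℝ) 1)).map (fun t : ℝ => b ^ t)

/-- The map `T_{f,a}(x) = f₊(f⁻¹(x+a) + 2a) + a`. -/
def Tmap (f : ℝ → EReal) (a : ℝ) : EReal → EReal :=
  fun x => fplus f (upperInvE f (x + (a : EReal)) + ((2 * a : ℝ) : EReal)) + (a : EReal)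

/-- The map `S_{f,a}(x) = f₊(f⁻¹(x+a)) + a`. -/
def Smap (f : ℝ → EReal) (a : ℝ) : EReal → EReal :=
  fun x => fplus f (upperInvE f (x + (a : EReal))) + (a : EReal)

/-- `L_•^{•,n} = min {a ≥ 0 : T_{F_μ,a}^{[n]}(0) ≥ 1}`. -/
def LBB (μ : Measure ℝ) (A B : ℝ) (n : ℕ) : ℝ :=
  sInf {a : ℝ | 0 ≤ a ∧ (1 : EReal) ≤ (Tmap (cdfEReal μ A B) a)^[n] ((0 : ℝ) : EReal)}

/-- `K_•^{•,n} = min {a ≥ 0 : S_{F_μ,a}^{[n]}(0) ≥ 1}`. -/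
def KBB (μ : Measure ℝ) (A B : ℝ) (n : ℕ) : ℝ :=
  sInf {a : ℝ | 0 ≤ a ∧ (1 : EReal) ≤ (Smap (cdfEReal μ A B) a)^[n] ((0 : ℝ) : EReal)}


/-- The locations `x_{n,j} = (1 + (j/(n+1))(b^{r/(r+1)} − 1))^{1+1/r}`, `j = 1,…,n`
(0-based index). -/
def benfordAsympX (b r : ℝ) (n : ℕ) (j : Fin n) : ℝ :=
  (1 + ((j : ℝ) + 1) / ((n : ℝ) + 1) * (b ^ (r / (r + 1)) - 1)) ^ (1 + 1 / r)

/-- The partial sums `P_{n,j}`; `P_{n,0} = 0`, `P_{n,n} = 1`, and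
`P_{n,j} = (1/log b)·log((x_{n,j} + x_{n,j+1})/2)` for `j = 1,…,n−1`. -/
def benfordAsympP (b r : ℝ) (n : ℕ) (j : ℕ) : ℝ :=
  if j = 0 then 0
  else if n ≤ j then 1
  else Real.log
      (((1 + (j : ℝ) / ((n : ℝ) + 1) * (b ^ (r / (r + 1)) - 1)) ^ (1 + 1 / r) +
        (1 + ((j : ℝ) + 1) / ((n : ℝ) + 1) * (b ^ (r / (r + 1)) - 1)) ^ (1 + 1 / r)) / 2) /
    Real.log b

/-- The corresponding weights `p_{n,j} = P_{n,j} − P_{n,j−1}`. -/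
def benfordAsympW (b r : ℝ) (n : ℕ) (j : Fin n) : ℝ :=
  benfordAsympP b r n ((j : ℕ) + 1) - benfordAsympP b r n (j : ℕ)

/-- Tangent-line inequality for the convex power `z ↦ z ^ k`, `k ≥ 1`. -/
lemma tangent_le_rpow {k w z : ℝ} (hk : 1 ≤ k) (hw : 0 < w) (hz : 0 ≤ z) :
    w ^ k + k * w ^ (k - 1) * (z - w) ≤ z ^ k := by
  have h := one_add_mul_self_le_rpow_one_add (s := z / w - 1) (p := k)
    (by have := div_nonneg hz hw.le; linarith) hk
  rw [add_sub_cancel, Real.div_rpow hz hw.le, le_div_iff₀ (Real.rpow_pos_of_pos hw k)] at h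
  have h1 : w ^ k = w ^ (k - 1) * w := by
    rw [← Real.rpow_add_one hw.ne']; congr 1; ring
  calc w ^ k + k * w ^ (k - 1) * (z - w) = (1 + k * (z / w - 1)) * w ^ k := by
        rw [h1]; field_simp
    _ ≤ _ := h

lemma rpow_mul_abs_le_abs_sub_rpow {r u v : ℝ} (hr : 0 < r) (hu : 0 < u) (hv : 0 < v) :
    (1 + 1 / r) ^ r * min u v * |u - v| ^ r ≤ |u ^ (1 + 1 / r) - v ^ (1 + 1 / r)| ^ r := by
  wlog h : u ≤ v generalizing u v
  · have := this hv hu (le_of_not_ge h)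
    rwa [min_comm, abs_sub_comm, abs_sub_comm (v ^ _)] at this
  have hk : (1 : ℝ) ≤ 1 + 1 / r := by have := one_div_pos.2 hr; linarith
  have ht := tangent_le_rpow hk hu hv.le
  rw [min_eq_left h]
  have e : (1 + 1 / r) ^ r * u * |u - v| ^ r = ((1 + 1 / r) * u ^ (1 / r) * (v - u)) ^ r := by
    rw [abs_sub_comm, abs_of_nonneg (sub_nonneg.2 h), Real.mul_rpow (by positivity)
      (sub_nonneg.2 h), Real.mul_rpow (by positivity) (by positivity), ← Real.rpow_mul hu.le,
      one_div_mul_cancel hr.ne', Real.rpow_one]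
  rw [e]
  have h0 : 0 ≤ (1 + 1 / r) * u ^ (1 / r) * (v - u) :=
    mul_nonneg (by positivity) (sub_nonneg.2 h)
  refine Real.rpow_le_rpow h0 ?_ hr.le
  rw [add_sub_cancel_left] at ht
  rw [abs_sub_comm]
  exact le_trans (by linarith) (le_abs_self _)

lemma abs_sub_rpow_le_rpow_mul_abs {r u v : ℝ} (hr : 0 < r) (hu : 0 < u) (hv : 0 < v) :
    |u ^ (1 + 1 / r) - v ^ (1 + 1 / r)| ^ r ≤ (1 + 1 / r) ^ r * max u v * |u - v| ^ r := by
  wlog h : u ≤ v generalizing u v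
  · have := this hv hu (le_of_not_ge h)
    rwa [max_comm, abs_sub_comm, abs_sub_comm v] at this
  have hk : (1 : ℝ) ≤ 1 + 1 / r := by have := one_div_pos.2 hr; linarith
  have ht := tangent_le_rpow hk hv hu.le
  rw [max_eq_right h]
  have e : (1 + 1 / r) ^ r * v * |u - v| ^ r = ((1 + 1 / r) * v ^ (1 / r) * (v - u)) ^ r := by
    rw [abs_sub_comm, abs_of_nonneg (sub_nonneg.2 h), Real.mul_rpow (by positivity)
      (sub_nonneg.2 h), Real.mul_rpow (by positivity) (by positivity), ← Real.rpow_mul hv.le,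
      one_div_mul_cancel hr.ne', Real.rpow_one]
  rw [e]
  have hm : u ^ (1 + 1 / r) ≤ v ^ (1 + 1 / r) := Real.rpow_le_rpow hu.le h (by linarith)
  refine Real.rpow_le_rpow (abs_nonneg _) ?_ hr.le
  rw [add_sub_cancel_left] at ht
  rw [abs_sub_comm, abs_of_nonneg (sub_nonneg.2 hm)]
  linarith

lemma abs_sub_rpow_le_mul_one_add {r u v d : ℝ} (hr : 0 < r) (hu : 1 ≤ u) (hv : 1 ≤ v)
    (hd : |u - v| ≤ d) :
    |u ^ (1 + 1 / r) - v ^ (1 + 1 / r)| ^ r ≤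
      u * ((1 + 1 / r) ^ r * (1 + d) * |u - v| ^ r) := by
  have hd0 := (abs_nonneg _).trans hd
  have hmax : max u v ≤ u * (1 + d) := by
    have := (abs_le.1 hd).1
    exact max_le (by nlinarith) (by nlinarith)
  refine (abs_sub_rpow_le_rpow_mul_abs hr (by linarith) (by linarith)).trans ?_
  calc _ ≤ (1 + 1 / r) ^ r * (u * (1 + d)) * |u - v| ^ r := by gcongr
    _ = _ := by ring

lemma mul_sub_abs_sub_rpow_le {r c T u v : ℝ} (hr : 1 < r) (hT : 0 < T) (hu : u ∈ Icc 1 c)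
    (hv : v ∈ Icc 1 c) :
    u * ((1 + 1 / r) * T) ^ r - |u ^ (1 + 1 / r) - v ^ (1 + 1 / r)| ^ r ≤
      u * ((1 + 1 / r) ^ r * max (T ^ r - (1 - T * c) * |u - v| ^ r) 0) := by
  obtain ⟨hu1, huc⟩ := hu
  obtain ⟨hv1, hvc⟩ := hv
  have hr0 : 0 < r := by linarith
  have hc : 1 ≤ c := hu1.trans huc
  have h := rpow_mul_abs_le_abs_sub_rpow hr0 (by linarith : 0 < u) (by linarith : 0 < v)
  rw [Real.mul_rpow (by positivity) hT.le]
  have hk : 0 < (1 + 1 / r) ^ r := by positivity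
  set κ := (1 + 1 / r) ^ r
  have hp : 0 ≤ |u - v| ^ r := by positivity
  rcases le_or_gt |u - v| (T * c) with hle | hgt
  · have hmin : u * (1 - T * c) ≤ min u v := by
      have := (abs_le.1 hle).2
      have hTc : 0 < T * c := by positivity
      exact le_min (by nlinarith) (by nlinarith)
    calc _ ≤ u * (κ * T ^ r) - κ * (u * (1 - T * c)) * |u - v| ^ r := by
          refine sub_le_sub_left (le_trans ?_ h) _
          gcongr
      _ = u * (κ * (T ^ r - (1 - T * c) * |u - v| ^ r)) := by ring
      _ ≤ _ := by gcongr; exact le_max_left _ _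
  · have h1 : c * T ^ r ≤ |u - v| ^ r := by
      calc c * T ^ r ≤ c ^ r * T ^ r := by
            gcongr
            simpa using Real.rpow_le_rpow_of_exponent_le hc hr.le
        _ = (T * c) ^ r := by rw [Real.mul_rpow hT.le (by linarith), mul_comm]
        _ ≤ _ := Real.rpow_le_rpow (by positivity) hgt.le hr0.le
    have h2 : u * (κ * T ^ r) ≤ κ * min u v * |u - v| ^ r := by
      calc u * (κ * T ^ r) ≤ c * (κ * T ^ r) := by gcongr
        _ = κ * 1 * (c * T ^ r) := by ring
        _ ≤ _ := by gcongr; exact le_min hu1 hv1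
    exact (sub_nonpos.2 (h2.trans h)).trans (by positivity)

lemma integral_Ioo_mul_comp_rpow {c : ℝ} (hc : 1 < c) (G : ℝ → ℝ) :
    ∫ t in Ioo (0 : ℝ) 1, c ^ t * G (c ^ t) = (Real.log c)⁻¹ * ∫ u in Ioo 1 c, G u := by
  have hlog := Real.log_pos hc
  have hc0 : 0 < c := by linarith
  have him : (fun t : ℝ => c ^ t) '' Ioo 0 1 = Ioo 1 c := by
    ext u
    constructor
    · rintro ⟨t, ht, rfl⟩
      exact ⟨Real.one_lt_rpow hc ht.1, by simpa using Real.rpow_lt_rpow_of_exponent_lt hc ht.2⟩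
    · rintro ⟨h1, h2⟩
      have h0 : 0 < u := by linarith
      refine ⟨Real.logb c u, ⟨Real.logb_pos hc h1, ?_⟩, Real.rpow_logb hc0 hc.ne' h0⟩
      rw [Real.logb_lt_iff_lt_rpow hc h0]; simpa
  have h := integral_image_eq_integral_abs_deriv_smul (s := Ioo (0 : ℝ) 1)
    (f := fun t : ℝ => c ^ t) (f' := fun t => c ^ t * Real.log c) measurableSet_Ioo
    (fun t _ => (by simpa [mul_comm] using (hasDerivAt_id t).const_rpow hc0 :
      HasDerivAt (fun t : ℝ => c ^ t) (c ^ t * Real.log c) t).hasDerivWithinAt)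
    ((Real.strictMono_rpow_of_base_gt_one hc).injective.injOn) G
  rw [him] at h
  rw [h, ← integral_const_mul]
  congr 1; ext t
  rw [abs_of_pos (by positivity), smul_eq_mul]; field_simp

lemma integrableOn_mul_comp_rpow {c : ℝ} (hc : 1 < c) {G : ℝ → ℝ} (hG : IntegrableOn G (Ioo 1 c)) :
    IntegrableOn (fun t : ℝ => c ^ t * G (c ^ t)) (Ioo 0 1) := by
  have hlog := Real.log_pos hc
  have hc0 : 0 < c := by linarith
  have him : (fun t : ℝ => c ^ t) '' Ioo 0 1 ⊆ Ioo 1 c := by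
    rintro _ ⟨t, ht, rfl⟩
    exact ⟨Real.one_lt_rpow hc ht.1, by simpa using Real.rpow_lt_rpow_of_exponent_lt hc ht.2⟩
  have h := (integrableOn_image_iff_integrableOn_abs_deriv_smul (s := Ioo (0 : ℝ) 1)
    (f := fun t : ℝ => c ^ t) (f' := fun t => c ^ t * Real.log c) measurableSet_Ioo
    (fun t _ => (by simpa [mul_comm] using (hasDerivAt_id t).const_rpow hc0 :
      HasDerivAt (fun t : ℝ => c ^ t) (c ^ t * Real.log c) t).hasDerivWithinAt)
    ((Real.strictMono_rpow_of_base_gt_one hc).injective.injOn) G).1 (hG.mono_set him)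
  refine (h.const_mul (Real.log c)⁻¹).congr (ae_of_all _ fun t => ?_)
  simp only [smul_eq_mul]
  rw [abs_of_pos (by positivity)]; field_simp

lemma integral_indicator_abs_rpow {r d : ℝ} (hr : 0 < r) (hd : 0 ≤ d) :
    ∫ x, (Icc (-d) d).indicator (fun x => |x| ^ r) x = 2 * (d ^ (r + 1) / (r + 1)) := by
  have : ∀ x : ℝ, (Icc (-d) d).indicator (fun x => |x| ^ r) x =
      (fun y => (Iic d).indicator (fun y : ℝ => y ^ r) y) |x| := by
    intro x
    simp only [indicator, mem_Icc, mem_Iic, abs_le]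
  simp_rw [this]
  rw [integral_comp_abs, setIntegral_indicator measurableSet_Iic, Ioi_inter_Iic,
    ← intervalIntegral.integral_of_le hd, integral_rpow (Or.inl (by linarith)),
    Real.zero_rpow (by linarith), sub_zero]

lemma integrable_indicator_abs_rpow {r d : ℝ} (hr : 0 < r) :
    Integrable ((Icc (-d) d).indicator (fun x : ℝ => |x| ^ r)) := by
  rw [integrable_indicator_iff measurableSet_Icc]
  exact (Continuous.rpow_const continuous_abs fun _ => Or.inr hr.le).continuousOn.integrableOn_Icc

lemma max_rpow_sub_eq_indicator {r d : ℝ} (hr : 0 < r) (hd : 0 ≤ d) (x : ℝ) :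
    max (d ^ r - |x| ^ r) 0 = (Icc (-d) d).indicator (fun _ => d ^ r) x -
      (Icc (-d) d).indicator (fun x => |x| ^ r) x := by
  by_cases hx : |x| ≤ d
  · have hm : x ∈ Icc (-d) d := abs_le.1 hx
    rw [indicator_of_mem hm, indicator_of_mem hm, max_eq_left]
    exact sub_nonneg.2 (Real.rpow_le_rpow (abs_nonneg _) hx hr.le)
  · have hm : x ∉ Icc (-d) d := fun h => hx (abs_le.2 h)
    rw [indicator_of_notMem hm, indicator_of_notMem hm, max_eq_right, sub_zero]
    exact sub_nonpos.2 (Real.rpow_le_rpow hd (not_le.1 hx).le hr.le)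

lemma integrable_indicator_const_Icc (d a : ℝ) :
    Integrable ((Icc (-d) d).indicator (fun _ : ℝ => a)) := by
  rw [integrable_indicator_iff measurableSet_Icc]
  exact continuousOn_const.integrableOn_Icc

lemma integral_indicator_const_Icc {d : ℝ} (hd : 0 ≤ d) (a : ℝ) :
    ∫ x, (Icc (-d) d).indicator (fun _ : ℝ => a) x = 2 * d * a := by
  rw [integral_indicator measurableSet_Icc, setIntegral_const, smul_eq_mul]
  simp only [measureReal_def, Real.volume_Icc]
  rw [ENNReal.toReal_ofReal (by linarith)]; ring

lemma integrable_max_rpow_sub {r d : ℝ} (hr : 0 < r) (hd : 0 ≤ d) :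
    Integrable (fun x : ℝ => max (d ^ r - |x| ^ r) 0) := by
  simp_rw [max_rpow_sub_eq_indicator hr hd]
  exact (integrable_indicator_const_Icc d _).sub (integrable_indicator_abs_rpow hr)

lemma integral_max_rpow_sub {r d : ℝ} (hr : 0 < r) (hd : 0 < d) :
    ∫ x : ℝ, max (d ^ r - |x| ^ r) 0 = 2 * (r / (r + 1)) * d ^ (r + 1) := by
  simp_rw [max_rpow_sub_eq_indicator hr hd.le]
  rw [integral_sub (integrable_indicator_const_Icc d _) (integrable_indicator_abs_rpow hr),
    integral_indicator_abs_rpow hr hd.le, integral_indicator_const_Icc hd.le,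
    Real.rpow_add_one hd.ne']
  field_simp; ring

lemma integrable_max_sub_mul_rpow {r T θ : ℝ} (hr : 0 < r) (hT : 0 < T) (hθ : 0 < θ) :
    Integrable (fun x : ℝ => max (T ^ r - θ * |x| ^ r) 0) ∧
    ∫ x : ℝ, max (T ^ r - θ * |x| ^ r) 0 = 2 * (r / (r + 1)) * T ^ (r + 1) * θ ^ (-(1 / r)) := by
  set d := T * θ ^ (-(1 / r)) with hd
  have hd0 : 0 < d := by positivity
  have hdr : θ * d ^ r = T ^ r := by
    rw [hd, Real.mul_rpow hT.le (by positivity), ← Real.rpow_mul hθ.le,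
      neg_mul, one_div_mul_cancel hr.ne', Real.rpow_neg_one]
    field_simp
  have e : ∀ x : ℝ, max (T ^ r - θ * |x| ^ r) 0 = θ * max (d ^ r - |x| ^ r) 0 := by
    intro x
    rw [mul_max_of_nonneg _ _ hθ.le, mul_sub, hdr, mul_zero]
  simp_rw [e]
  refine ⟨(integrable_max_rpow_sub hr hd0.le).const_mul θ, ?_⟩
  rw [integral_const_mul, integral_max_rpow_sub hr hd0, Real.rpow_add_one hd0.ne',
    Real.rpow_add_one hT.ne', ← hdr, hd]
  ring

lemma discr_toReal {n : ℕ} (x : Fin n → ℝ) {p : Fin n → ℝ} (hp : ∀ j, 0 ≤ p j) {S : Set ℝ}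
    (hS : MeasurableSet S) [DecidablePred (· ∈ S)] :
    (discr n x p S).toReal = ∑ j, if x j ∈ S then p j else 0 := by
  rw [discr, Measure.finsetSum_apply, ENNReal.toReal_sum]
  · refine Finset.sum_congr rfl fun j _ => ?_
    rw [Measure.smul_apply, Measure.dirac_apply' _ hS, smul_eq_mul]
    by_cases h : x j ∈ S <;> simp [h, hp j]
  · intro j _
    rw [Measure.smul_apply, Measure.dirac_apply' _ hS, smul_eq_mul]
    by_cases h : x j ∈ S <;> simp [h]

lemma psum_mono {n : ℕ} {p : Fin n → ℝ} (hp : ∀ j, 0 ≤ p j) : Monotone (psum n p) := by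
  intro i k hik
  refine Finset.sum_le_sum fun j _ => ?_
  have := hp j
  split_ifs <;> first | omega | linarith

lemma psum_self {n : ℕ} {p : Fin n → ℝ} (hp : IsPi n p) : psum n p n = 1 := by
  rw [← hp.2]
  exact Finset.sum_congr rfl fun j _ => if_pos j.2

/-- On `[0, 1)` the quantile function of `δ_x^p` equals `x_j` between consecutive
partial sums of the weights. -/
lemma exists_quant_discr_eq {A B : ℝ} {n : ℕ} {x p : Fin n → ℝ} (hx : IsXi A B n x)
    (hp : IsPi n p) {t : ℝ} (ht0 : 0 ≤ t) (ht1 : t < 1) :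
    ∃ j : Fin n, quant (discr n x p) A B t = x j ∧ psum n p j ≤ t ∧ t < psum n p (j + 1) := by
  classical
  have hex : ∃ k, t < psum n p k := ⟨n, by rwa [psum_self hp]⟩
  obtain ⟨hk, hmin⟩ := Nat.find_spec hex, fun m (h : m < Nat.find hex) => Nat.find_min hex h
  have hkn : Nat.find hex ≤ n := Nat.find_min' hex (by rwa [psum_self hp])
  generalize Nat.find hex = k at *
  obtain _ | m := k
  · simp [psum] at hk; linarith
  have hm := not_lt.1 (hmin m (Nat.lt_succ_self m))
  refine ⟨⟨m, hkn⟩, ?_, hm, hk⟩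
  set j : Fin n := ⟨m, hkn⟩
  have hlow : ∀ y, y < x j → ∀ S : Set ℝ, MeasurableSet S → S ⊆ Iic y →
      (discr n x p S).toReal ≤ t := by
    intro y hy S hS hSy
    rw [discr_toReal x hp.1 hS]
    refine le_trans (Finset.sum_le_sum fun i _ => ?_) hm
    have := hp.1 i
    split_ifs with h1 h2
    · exact le_rfl
    · have : x j ≤ x i := hx.2 (by simpa [Fin.le_def, j] using h2)
      exact absurd (hSy h1) (by simp; linarith)
    · exact this
    · exact le_rfl
  have hhigh : ∀ S : Set ℝ, MeasurableSet S → Icc A (x j) ⊆ S → t < (discr n x p S).toReal := by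
    intro S hS hSy
    rw [discr_toReal x hp.1 hS]
    refine lt_of_lt_of_le hk (Finset.sum_le_sum fun i _ => ?_)
    have := hp.1 i
    split_ifs with h1 h2 h2
    · exact le_rfl
    · have : x i ≤ x j := hx.2 (by simp only [Fin.le_def, j]; omega)
      exact absurd (hSy ⟨(hx.1 i).1, this⟩) h2
    · exact this
    · exact le_rfl
  rcases (hx.1 j).1.eq_or_lt with hA | hA
  · rw [quant, if_pos (Or.inl ?_), hA]
    exact hhigh _ (measurableSet_singleton A) (by rw [← hA]; simp)
  · rw [quant, if_neg]
    · have : {y ∈ Icc A B | cdf (discr n x p) A B y ≤ t} = Ico A (x j) := by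
        ext y
        simp only [mem_ofPred_eq, mem_Icc, mem_Ico, cdf]
        constructor
        · rintro ⟨⟨h1, h2⟩, h3⟩
          refine ⟨h1, lt_of_not_ge fun h => h3.not_gt (hhigh _
            (measurableSet_Icc.inter measurableSet_Iic) ?_)⟩
          exact fun z hz => ⟨⟨hz.1, hz.2.trans (hx.1 j).2⟩, hz.2.trans h⟩
        · rintro ⟨h1, h2⟩
          exact ⟨⟨h1, h2.le.trans (hx.1 j).2⟩, hlow y h2 _
            (measurableSet_Icc.inter measurableSet_Iic) inter_subset_right⟩
      rw [this, csSup_Ico hA]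
    · rintro (h | h)
      · exact h.not_ge (hlow A hA _ (measurableSet_singleton A) (by simp))
      · linarith

lemma monotoneOn_quant_discr {A B : ℝ} {n : ℕ} {x p : Fin n → ℝ} (hx : IsXi A B n x)
    (hp : IsPi n p) : MonotoneOn (quant (discr n x p) A B) (Ioo 0 1) := by
  intro s hs t ht hst
  obtain ⟨i, hi, hi1, hi2⟩ := exists_quant_discr_eq hx hp hs.1.le hs.2
  obtain ⟨j, hj, hj1, hj2⟩ := exists_quant_discr_eq hx hp ht.1.le ht.2
  rw [hi, hj]
  refine hx.2 (le_of_not_gt fun h => ?_)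
  have := psum_mono hp.1 (show (j : ℕ) + 1 ≤ i from h)
  linarith

lemma benford_apply {b : ℝ} (hb : 1 < b) {S : Set ℝ} (hS : MeasurableSet S) :
    benford b S = volume ((fun t : ℝ => b ^ t) ⁻¹' S ∩ Ico 0 1) := by
  have hm : Measurable (fun t : ℝ => b ^ t) :=
    (Real.continuous_const_rpow (by linarith)).measurable
  rw [benford, Measure.map_apply hm hS, Measure.restrict_apply (hm hS)]

lemma quant_benford {b : ℝ} (hb : 1 < b) {t : ℝ} (ht : t ∈ Ioo (0 : ℝ) 1) :
    quant (benford b) 1 b t = b ^ t := by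
  obtain ⟨ht0, ht1⟩ := ht
  have hb0 : 0 < b := by linarith
  have hmono : ∀ {s u : ℝ}, b ^ s ≤ b ^ u ↔ s ≤ u := fun {s u} => Real.rpow_le_rpow_left_iff hb
  have hsing : benford b {1} = 0 := by
    rw [benford_apply hb (measurableSet_singleton 1)]
    refine measure_mono_null (t := {0}) ?_ (by simp)
    rintro s ⟨hs, -⟩
    have h1 : b ^ s = b ^ (0 : ℝ) := by simpa using hs
    exact (Real.strictMono_rpow_of_base_gt_one hb).injective h1
  rw [quant, if_neg (by rw [hsing]; simp [ht0.le])]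
  have : {y ∈ Icc 1 b | cdf (benford b) 1 b y ≤ t} = Icc 1 (b ^ t) := by
    ext y
    simp only [mem_ofPred_eq, mem_Icc, cdf]
    rw [benford_apply hb (measurableSet_Icc.inter measurableSet_Iic)]
    constructor
    · rintro ⟨⟨h1, h2⟩, h3⟩
      refine ⟨h1, le_of_not_gt fun h => ?_⟩
      have hy0 : 0 < y := by linarith
      have hle : Ico 0 (Real.logb b y) ⊆
          (fun t : ℝ => b ^ t) ⁻¹' (Icc 1 b ∩ Iic y) ∩ Ico 0 1 := by
        rintro s ⟨hs0, hs1⟩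
        have hsy : b ^ s < y := by
          rwa [Real.lt_logb_iff_rpow_lt hb hy0] at hs1
        refine ⟨⟨⟨Real.one_le_rpow hb.le hs0, by linarith⟩, hsy.le⟩, hs0, ?_⟩
        have : b ^ s < b ^ (1 : ℝ) := by simpa using hsy.trans_le h2
        exact (Real.rpow_lt_rpow_left_iff hb).1 this
      have hty : t < Real.logb b y := by rwa [Real.lt_logb_iff_rpow_lt hb hy0]
      have hv := measure_mono (μ := volume) hle
      rw [Real.volume_Ico, sub_zero] at hv
      have hfin : volume ((fun t : ℝ => b ^ t) ⁻¹' (Icc 1 b ∩ Iic y) ∩ Ico 0 1) ≠ ⊤ :=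
        ne_top_of_le_ne_top (by simp) (measure_mono inter_subset_right)
      have := (ENNReal.ofReal_le_iff_le_toReal hfin).1 hv
      linarith
    · rintro ⟨h1, h2⟩
      have htb : b ^ t ≤ b := by simpa using hmono.2 ht1.le
      refine ⟨⟨h1, h2.trans htb⟩, ?_⟩
      have hle : (fun t : ℝ => b ^ t) ⁻¹' (Icc 1 b ∩ Iic y) ∩ Ico 0 1 ⊆ Icc 0 t := by
        rintro s ⟨⟨-, hs⟩, hs0, -⟩
        exact ⟨hs0, hmono.1 (le_trans hs h2)⟩
      have hv := measure_mono (μ := volume) hle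
      rw [Real.volume_Icc, sub_zero] at hv
      exact ENNReal.toReal_le_of_le_ofReal ht0.le hv
  rw [this, csSup_Icc (Real.one_le_rpow hb.le ht0.le)]

lemma rpow_mul_exponents {r a : ℝ} (hr : 0 < r) (ha : 0 ≤ a) :
    (a ^ (r / (r + 1))) ^ (1 + 1 / r) = a := by
  rw [← Real.rpow_mul ha]
  have : r / (r + 1) * (1 + 1 / r) = 1 := by field_simp
  rw [this, Real.rpow_one]

lemma rpow_rpow_exponents {r b : ℝ} (hr : 0 < r) (hb : 0 ≤ b) (t : ℝ) :
    ((b ^ (r / (r + 1))) ^ t) ^ (1 + 1 / r) = b ^ t := by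
  rw [← Real.rpow_mul (by positivity), mul_comm t, Real.rpow_mul (by positivity),
    rpow_mul_exponents hr hb]

lemma integrableOn_abs_benford_sub_quant {b r : ℝ} (hb : 1 < b) (hr : 0 < r) {n : ℕ}
    {y q : Fin n → ℝ} (hy : IsXi 1 b n y) (hq : IsPi n q) :
    IntegrableOn (fun t => |b ^ t - quant (discr n y q) 1 b t| ^ r) (Ioo 0 1) := by
  refine IntegrableOn.of_bound (by simp) ?_ (b ^ r) ?_
  · have h1 : AEMeasurable (quant (discr n y q) 1 b) (volume.restrict (Ioo 0 1)) :=
      aemeasurable_restrict_of_monotoneOn measurableSet_Ioo (monotoneOn_quant_discr hy hq)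
    have h2 : Measurable (fun t : ℝ => b ^ t) :=
      (Real.continuous_const_rpow (by linarith)).measurable
    exact ((measurable_norm.comp_aemeasurable (h2.aemeasurable.sub h1)).pow_const
      r).aestronglyMeasurable
  · refine (ae_restrict_iff' measurableSet_Ioo).2 (ae_of_all _ fun t ht => ?_)
    obtain ⟨j, hj, -⟩ := exists_quant_discr_eq hy hq ht.1.le ht.2
    rw [hj, Real.norm_of_nonneg (by positivity)]
    refine Real.rpow_le_rpow (abs_nonneg _) ?_ hr.le
    have h1 : 1 ≤ b ^ t := Real.one_le_rpow hb.le ht.1.le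
    have h2 : b ^ t ≤ b := by simpa using Real.rpow_le_rpow_of_exponent_le hb.le ht.2.le
    have := hy.1 j
    exact abs_le.2 ⟨by linarith [this.2], by linarith [this.1]⟩

lemma sub_le_integral_abs_benford_sub_quant {b r T : ℝ} (hb : 1 < b) (hr : 1 < r) {n : ℕ}
    {y q : Fin n → ℝ} (hy : IsXi 1 b n y) (hq : IsPi n q) (hT : 0 < T)
    (hθ : 0 < 1 - T * b ^ (r / (r + 1))) :
    (Real.log (b ^ (r / (r + 1))))⁻¹ * ((1 + 1 / r) ^ r * (T ^ r * (b ^ (r / (r + 1)) - 1) -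
      n * (2 * (r / (r + 1)) * T ^ (r + 1) * (1 - T * b ^ (r / (r + 1))) ^ (-(1 / r))))) ≤
    ∫ t in Ioo (0 : ℝ) 1, |quant (benford b) 1 b t - quant (discr n y q) 1 b t| ^ r := by
  have hr0 : 0 < r := by linarith
  have hb0 : 0 < b := by linarith
  have hpow := rpow_rpow_exponents hr0 hb0.le
  have hc : 1 < b ^ (r / (r + 1)) := Real.one_lt_rpow hb (by positivity)
  have hyc : ∀ j, y j ^ (r / (r + 1)) ∈ Icc 1 (b ^ (r / (r + 1))) := fun j =>
    ⟨Real.one_le_rpow (hy.1 j).1 (by positivity),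
      Real.rpow_le_rpow (by linarith [(hy.1 j).1]) (hy.1 j).2 (by positivity)⟩
  have hyp : ∀ j, (y j ^ (r / (r + 1))) ^ (1 + 1 / r) = y j := fun j =>
    rpow_mul_exponents hr0 (by linarith [(hy.1 j).1])
  generalize b ^ (r / (r + 1)) = c at *
  set θ := 1 - T * c with hθdef
  obtain ⟨hMi, hMint⟩ := integrable_max_sub_mul_rpow hr0 hT hθ
  set M : ℝ → ℝ := fun x => max (T ^ r - θ * |x| ^ r) 0 with hM
  have hM0 : ∀ x, 0 ≤ M x := fun x => le_max_right _ _
  set κ := (1 + 1 / r) ^ r with hκ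
  have hκ0 : 0 < κ := by positivity
  set G : ℝ → ℝ := fun u => κ * T ^ r - ∑ j, κ * M (u - y j ^ (r / (r + 1))) with hG
  have hMj : ∀ j, IntegrableOn (fun u => κ * M (u - y j ^ (r / (r + 1)))) (Ioo 1 c) := fun j =>
    ((hMi.comp_sub_right _).const_mul κ).integrableOn
  have hsum : IntegrableOn (fun u => ∑ j, κ * M (u - y j ^ (r / (r + 1)))) (Ioo 1 c) :=
    integrable_finsetSum _ fun j _ => hMj j
  have hconst : IntegrableOn (fun _ : ℝ => κ * T ^ r) (Ioo 1 c) :=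
    integrableOn_const (by simp)
  have hGi : IntegrableOn G (Ioo 1 c) := hconst.sub hsum
  have hGint : κ * (T ^ r * (c - 1) - n * (2 * (r / (r + 1)) * T ^ (r + 1) * θ ^ (-(1 / r)))) ≤
      ∫ u in Ioo 1 c, G u := by
    rw [hG, integral_sub hconst hsum, integral_finsetSum _ fun j _ => hMj j, setIntegral_const,
      measureReal_def, Real.volume_Ioo, ENNReal.toReal_ofReal (by linarith), smul_eq_mul]
    have hj : ∀ j, ∫ u in Ioo 1 c, κ * M (u - y j ^ (r / (r + 1))) ≤
        κ * (2 * (r / (r + 1)) * T ^ (r + 1) * θ ^ (-(1 / r))) := by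
      intro j
      rw [integral_const_mul, ← hMint, ← integral_sub_right_eq_self M (y j ^ (r / (r + 1)))]
      exact mul_le_mul_of_nonneg_left (setIntegral_le_integral (hMi.comp_sub_right _)
        (ae_of_all _ fun x => hM0 _)) hκ0.le
    have := Finset.sum_le_sum fun j (_ : j ∈ Finset.univ) => hj j
    rw [Finset.sum_const, Finset.card_univ, Fintype.card_fin, nsmul_eq_mul] at this
    linarith
  calc _ ≤ (Real.log c)⁻¹ * ∫ u in Ioo 1 c, G u :=
        mul_le_mul_of_nonneg_left hGint (inv_nonneg.2 (Real.log_pos hc).le)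
    _ = ∫ t in Ioo (0 : ℝ) 1, c ^ t * G (c ^ t) := (integral_Ioo_mul_comp_rpow hc G).symm
    _ ≤ ∫ t in Ioo (0 : ℝ) 1, |b ^ t - quant (discr n y q) 1 b t| ^ r := by
        refine setIntegral_mono_on (integrableOn_mul_comp_rpow hc hGi)
          (integrableOn_abs_benford_sub_quant hb hr0 hy hq) measurableSet_Ioo fun t ht => ?_
        obtain ⟨j, hj, -⟩ := exists_quant_discr_eq hy hq ht.1.le ht.2
        have hu : c ^ t ∈ Icc 1 c := ⟨Real.one_le_rpow hc.le ht.1.le,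
          by simpa using Real.rpow_le_rpow_of_exponent_le hc.le ht.2.le⟩
        have h := mul_sub_abs_sub_rpow_le hr hT hu (hyc j)
        rw [hpow, hyp, Real.mul_rpow (by positivity) hT.le] at h
        have h2 := Finset.single_le_sum (f := fun j => κ * M (c ^ t - y j ^ (r / (r + 1))))
          (fun i _ => mul_nonneg hκ0.le (hM0 _)) (Finset.mem_univ j)
        have h3 := mul_le_mul_of_nonneg_left h2 (zero_le_one.trans hu.1)
        rw [hj]
        simp only [hG, mul_sub]
        simp only [hM] at h3
        linarith
    _ = _ := setIntegral_congr_fun measurableSet_Ioo fun t ht => by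
        simp only [quant_benford hb ht]

/-- Location on the equidistant grid of `n + 2` points of `[1, c]`. -/
def grid (c : ℝ) (n : ℕ) (k : ℝ) : ℝ := 1 + k / ((n : ℝ) + 1) * (c - 1)

lemma grid_mono {c : ℝ} (hc : 1 ≤ c) (n : ℕ) : Monotone (grid c n) := by
  intro k l h
  have : 0 ≤ c - 1 := by linarith
  simp only [grid]; gcongr

lemma one_le_grid {c k : ℝ} (hc : 1 ≤ c) (n : ℕ) (hk : 0 ≤ k) : 1 ≤ grid c n k := by
  have := grid_mono hc n hk
  simpa [grid] using this

lemma grid_le {c k : ℝ} (hc : 1 ≤ c) (n : ℕ) (hk : k ≤ n + 1) : grid c n k ≤ c := by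
  have := grid_mono hc n hk
  have h : (n : ℝ) + 1 ≠ 0 := by positivity
  simpa [grid, h] using this

lemma benfordAsympX_eq (b r : ℝ) (n : ℕ) (j : Fin n) :
    benfordAsympX b r n j = grid (b ^ (r / (r + 1))) n ((j : ℝ) + 1) ^ (1 + 1 / r) := rfl

lemma isXi_benfordAsympX {b r : ℝ} (hb : 1 < b) (hr : 0 < r) (n : ℕ) :
    IsXi 1 b n (benfordAsympX b r n) := by
  have hc : 1 ≤ b ^ (r / (r + 1)) := Real.one_le_rpow hb.le (by positivity)
  have hj : ∀ j : Fin n, 1 ≤ grid (b ^ (r / (r + 1))) n ((j : ℝ) + 1) :=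
    fun j => one_le_grid hc n (by positivity)
  refine ⟨fun j => ⟨Real.one_le_rpow (hj j) (by positivity), ?_⟩, fun i j hij => ?_⟩
  · conv_rhs => rw [← rpow_mul_exponents hr (zero_le_one.trans hb.le)]
    refine Real.rpow_le_rpow (zero_le_one.trans (hj j)) (grid_le hc n ?_) (by positivity)
    have : (j : ℝ) ≤ n := by exact_mod_cast j.2.le
    linarith
  · refine Real.rpow_le_rpow (zero_le_one.trans (hj i)) (grid_mono hc n ?_) (by positivity)
    have : (i : ℝ) ≤ j := by exact_mod_cast hij
    linarith

/-- The midpoint of the locations with (one-based) indices `j` and `j + 1`. -/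
def gridMid (b r : ℝ) (n j : ℕ) : ℝ :=
  (grid (b ^ (r / (r + 1))) n j ^ (1 + 1 / r) +
    grid (b ^ (r / (r + 1))) n (j + 1) ^ (1 + 1 / r)) / 2

lemma benfordAsympP_of_lt (b r : ℝ) {n j : ℕ} (hj : 0 < j) (hjn : j < n) :
    benfordAsympP b r n j = Real.logb b (gridMid b r n j) := by
  rw [benfordAsympP, if_neg hj.ne', if_neg (not_le.2 hjn)]; rfl

lemma gridMid_mono {b r : ℝ} (hb : 1 < b) (hr : 0 < r) (n : ℕ) : Monotone (gridMid b r n) := by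
  have hc : 1 ≤ b ^ (r / (r + 1)) := Real.one_le_rpow hb.le (by positivity)
  intro i j hij
  have hij' : (i : ℝ) ≤ j := by exact_mod_cast hij
  have h : ∀ k l : ℝ, 0 ≤ k → k ≤ l → grid (b ^ (r / (r + 1))) n k ^ (1 + 1 / r) ≤
      grid (b ^ (r / (r + 1))) n l ^ (1 + 1 / r) := fun k l hk hkl =>
    Real.rpow_le_rpow (zero_le_one.trans (one_le_grid hc n hk)) (grid_mono hc n hkl)
      (by positivity)
  have h1 := h i j (by positivity) hij'
  have h2 := h (i + 1) (j + 1) (by positivity) (by linarith)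
  simp only [gridMid]; linarith

lemma one_le_gridMid {b r : ℝ} (hb : 1 < b) (hr : 0 < r) (n j : ℕ) : 1 ≤ gridMid b r n j := by
  have hc : 1 ≤ b ^ (r / (r + 1)) := Real.one_le_rpow hb.le (by positivity)
  have h : ∀ k : ℝ, 0 ≤ k → 1 ≤ grid (b ^ (r / (r + 1))) n k ^ (1 + 1 / r) := fun k hk =>
    Real.one_le_rpow (one_le_grid hc n hk) (by positivity)
  have h1 := h j (by positivity)
  have h2 := h (j + 1) (by positivity)
  simp only [gridMid]; linarith

lemma gridMid_le {b r : ℝ} (hb : 1 < b) (hr : 0 < r) {n j : ℕ} (hj : j < n) :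
    gridMid b r n j ≤ b := by
  have hc : 1 ≤ b ^ (r / (r + 1)) := Real.one_le_rpow hb.le (by positivity)
  have hj' : (j : ℝ) < n := by exact_mod_cast hj
  have h : ∀ k : ℝ, 0 ≤ k → k ≤ n + 1 → grid (b ^ (r / (r + 1))) n k ^ (1 + 1 / r) ≤ b := by
    intro k hk hkn
    conv_rhs => rw [← rpow_mul_exponents hr (zero_le_one.trans hb.le)]
    exact Real.rpow_le_rpow (zero_le_one.trans (one_le_grid hc n hk)) (grid_le hc n hkn)
      (by positivity)
  have h1 := h j (by positivity) (by linarith)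
  have h2 := h (j + 1) (by positivity) (by linarith)
  simp only [gridMid]; linarith

lemma benfordAsympP_mono {b r : ℝ} (hb : 1 < b) (hr : 0 < r) (n : ℕ) (j : ℕ) (hj : j < n) :
    benfordAsympP b r n j ≤ benfordAsympP b r n (j + 1) := by
  have hpos : ∀ k, 0 < gridMid b r n k := fun k => zero_lt_one.trans_le (one_le_gridMid hb hr n k)
  have hlo : ∀ k, 0 ≤ Real.logb b (gridMid b r n k) := fun k =>
    Real.logb_nonneg hb (one_le_gridMid hb hr n k)
  have hlast : benfordAsympP b r n n = 1 := by
    simp [benfordAsympP]; omega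
  rcases Nat.eq_zero_or_pos j with rfl | hj0
  · have h0 : benfordAsympP b r n 0 = 0 := by simp [benfordAsympP]
    rw [h0]
    rcases (show 0 + 1 ≤ n from hj).eq_or_lt with h | h
    · rw [h, hlast]; exact zero_le_one
    · rw [benfordAsympP_of_lt b r (by omega) h]; exact hlo _
  · rw [benfordAsympP_of_lt b r hj0 hj]
    rcases (show j + 1 ≤ n from hj).eq_or_lt with h | h
    · rw [h, hlast, Real.logb_le_iff_le_rpow hb (hpos j), Real.rpow_one]
      exact gridMid_le hb hr hj
    · rw [benfordAsympP_of_lt b r (by omega) h]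
      exact Real.logb_le_logb_of_le hb (hpos j) (gridMid_mono hb hr n (Nat.le_succ j))

lemma psum_benfordAsympW (b r : ℝ) {n k : ℕ} (hk : k ≤ n) :
    psum n (benfordAsympW b r n) k = benfordAsympP b r n k := by
  have h : psum n (benfordAsympW b r n) k = ∑ i ∈ Finset.range n, if i < k then
      benfordAsympP b r n (i + 1) - benfordAsympP b r n i else 0 :=
    Fin.sum_univ_eq_sum_range (fun i => if i < k then
      benfordAsympP b r n (i + 1) - benfordAsympP b r n i else 0) n
  rw [h, ← Finset.sum_filter]
  have h2 : (Finset.range n).filter (· < k) = Finset.range k := by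
    ext i; simp only [Finset.mem_filter, Finset.mem_range]; omega
  rw [h2, Finset.sum_range_sub]
  simp [benfordAsympP]

lemma isPi_benfordAsympW {b r : ℝ} (hb : 1 < b) (hr : 0 < r) {n : ℕ} (hn : 0 < n) :
    IsPi n (benfordAsympW b r n) := by
  refine ⟨fun j => sub_nonneg.2 (benfordAsympP_mono hb hr n j j.2), ?_⟩
  have h := psum_benfordAsympW b r (le_refl n)
  have h1 : psum n (benfordAsympW b r n) n = ∑ j, benfordAsympW b r n j :=
    Finset.sum_congr rfl fun j _ => if_pos j.2
  rw [← h1, h]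
  simp [benfordAsympP, hn.ne']

/-- The quantile function of `δ_{x_n}^{p_n}` picks the location nearest to `b ^ t`. -/
lemma abs_sub_quant_benfordAsymp_le {b r : ℝ} (hb : 1 < b) (hr : 0 < r) {n : ℕ} {t : ℝ}
    (ht : t ∈ Ioo (0 : ℝ) 1) (i : Fin n) :
    |b ^ t - quant (discr n (benfordAsympX b r n) (benfordAsympW b r n)) 1 b t| ≤
      |b ^ t - benfordAsympX b r n i| := by
  have hn : 0 < n := i.pos
  have hX := isXi_benfordAsympX hb hr n
  obtain ⟨j, hj, h1, h2⟩ := exists_quant_discr_eq hX (isPi_benfordAsympW hb hr hn) ht.1.le ht.2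
  rw [hj]
  have hpos : ∀ k, 0 < gridMid b r n k := fun k => zero_lt_one.trans_le (one_le_gridMid hb hr n k)
  rw [psum_benfordAsympW b r j.2.le] at h1
  rw [psum_benfordAsympW b r j.2] at h2
  rcases lt_trichotomy i j with hij | rfl | hij
  · have hij' : (i : ℕ) < j := hij
    rw [benfordAsympP_of_lt b r (by omega) j.2, Real.logb_le_iff_le_rpow hb (hpos _)] at h1
    have hm : benfordAsympX b r n i + benfordAsympX b r n j ≤ 2 * gridMid b r n j := by
      have h3 := hX.2 (show i ≤ ⟨j - 1, by omega⟩ by simp only [Fin.le_def]; omega)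
      have h4 : benfordAsympX b r n ⟨j - 1, by omega⟩ =
          grid (b ^ (r / (r + 1))) n j ^ (1 + 1 / r) := by
        rw [benfordAsympX_eq]
        simp [Nat.cast_sub (show 1 ≤ (j : ℕ) by omega)]
      have h5 := benfordAsympX_eq b r n j
      simp only [gridMid]; linarith
    have h6 := hX.2 hij.le
    rw [abs_of_nonneg (show 0 ≤ b ^ t - benfordAsympX b r n i by linarith)]
    exact abs_le.2 ⟨by linarith, by linarith⟩
  · exact le_rfl
  · have hij' : (j : ℕ) < i := hij
    rw [benfordAsympP_of_lt b r (by omega) (by omega), Real.lt_logb_iff_rpow_lt hb (hpos _)] at h2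
    have hm : 2 * gridMid b r n (j + 1) ≤ benfordAsympX b r n i + benfordAsympX b r n j := by
      have h3 := hX.2 (show ⟨j + 1, by omega⟩ ≤ i by simp only [Fin.le_def]; omega)
      have h4 : benfordAsympX b r n ⟨j + 1, by omega⟩ =
          grid (b ^ (r / (r + 1))) n ((j + 1 : ℕ) + 1) ^ (1 + 1 / r) := by
        rw [benfordAsympX_eq]
      have h5 := benfordAsympX_eq b r n j
      simp only [gridMid, Nat.cast_add, Nat.cast_one] at h4 ⊢; linarith
    have h6 := hX.2 hij.le
    rw [abs_of_nonpos (show b ^ t - benfordAsympX b r n i ≤ 0 by linarith)]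
    exact abs_le.2 ⟨by linarith, by linarith⟩

/-- Upper envelope of the `r`-th power of the distance to the interior grid points: the exact
power near interior grid points, a crude constant near the two end points. -/
def gridEnvelope (c r d : ℝ) (n : ℕ) (u : ℝ) : ℝ :=
  ∑ i : Fin n, (Icc (-d) d).indicator (fun x => |x| ^ r) (u - grid c n ((i : ℝ) + 1)) +
    ((Icc (-d) d).indicator (fun _ => (3 * d) ^ r) (u - 1) +
      (Icc (-d) d).indicator (fun _ => (3 * d) ^ r) (u - c))

lemma gridEnvelope_integrable {c r d : ℝ} (hr : 0 < r) (n : ℕ) :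
    Integrable (gridEnvelope c r d n) :=
  (integrable_finsetSum _ fun _ _ => (integrable_indicator_abs_rpow hr).comp_sub_right _).add
    (((integrable_indicator_const_Icc d _).comp_sub_right _).add
      ((integrable_indicator_const_Icc d _).comp_sub_right _))

lemma gridEnvelope_nonneg {c r d : ℝ} (hd : 0 ≤ d) (n : ℕ) (u : ℝ) :
    0 ≤ gridEnvelope c r d n u := by
  refine add_nonneg (Finset.sum_nonneg fun i _ => indicator_nonneg (fun x _ => ?_) _)
    (add_nonneg (indicator_nonneg (fun x _ => ?_) _) (indicator_nonneg (fun x _ => ?_) _)) <;>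
    positivity

lemma integral_gridEnvelope {c r d : ℝ} (hr : 0 < r) (hd : 0 ≤ d) (n : ℕ) :
    ∫ u, gridEnvelope c r d n u =
      n * (2 * (d ^ (r + 1) / (r + 1))) + 4 * d * (3 * d) ^ r := by
  have h1 : ∀ i : Fin n, Integrable (fun u => (Icc (-d) d).indicator (fun x => |x| ^ r)
      (u - grid c n ((i : ℝ) + 1))) := fun i => (integrable_indicator_abs_rpow hr).comp_sub_right _
  have h2 : ∀ a : ℝ, Integrable (fun u => (Icc (-d) d).indicator (fun _ => (3 * d) ^ r)
      (u - a)) := fun a => (integrable_indicator_const_Icc d _).comp_sub_right _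
  have e1 : ∀ a : ℝ, ∫ u, (Icc (-d) d).indicator (fun x => |x| ^ r) (u - a) =
      2 * (d ^ (r + 1) / (r + 1)) := fun a => by
    rw [integral_sub_right_eq_self (fun x => (Icc (-d) d).indicator (fun x => |x| ^ r) x),
      integral_indicator_abs_rpow hr hd]
  have e2 : ∀ a : ℝ, ∫ u, (Icc (-d) d).indicator (fun _ => (3 * d) ^ r) (u - a) =
      2 * d * (3 * d) ^ r := fun a => by
    rw [integral_sub_right_eq_self (fun x => (Icc (-d) d).indicator (fun _ => (3 * d) ^ r) x),
      integral_indicator_const_Icc hd]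
  simp only [gridEnvelope]
  have h3 : Integrable (fun u => (Icc (-d) d).indicator (fun _ => (3 * d) ^ r) (u - 1) +
      (Icc (-d) d).indicator (fun _ => (3 * d) ^ r) (u - c)) := (h2 1).add (h2 c)
  rw [integral_add (integrable_finsetSum _ fun i _ => h1 i) h3,
    integral_finsetSum _ fun i _ => h1 i, integral_add (h2 1) (h2 c)]
  simp only [e1, e2, Finset.sum_const, Finset.card_univ, Fintype.card_fin, nsmul_eq_mul]
  ring

lemma exists_rpow_le_gridEnvelope {c r u : ℝ} (hc : 1 < c) (hr : 0 < r) {n : ℕ} (hn : 0 < n)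
    {d : ℝ} (hd : d = (c - 1) / (2 * ((n : ℝ) + 1))) (hu : u ∈ Icc 1 c) :
    ∃ i : Fin n, |u - grid c n ((i : ℝ) + 1)| ≤ 3 * d ∧
      |u - grid c n ((i : ℝ) + 1)| ^ r ≤ gridEnvelope c r d n u := by
  have hn1 : (0 : ℝ) < n + 1 := by positivity
  have hd0 : 0 < d := by rw [hd]; exact div_pos (by linarith) (by positivity)
  have hgrid : ∀ k, grid c n k = 1 + 2 * d * k := fun k => by
    rw [grid, hd]; field_simp
  have hcd : c = 1 + 2 * d * (n + 1) := by rw [hd]; field_simp; ring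
  set x := (u - 1) / (2 * d) with hx
  have hux : u = 1 + 2 * d * x := by rw [hx]; field_simp; ring
  have hx0 : 0 ≤ x := div_nonneg (by linarith [hu.1]) (by positivity)
  have hxn : x ≤ n + 1 := by
    rw [hx, div_le_iff₀ (by positivity)]; linarith [hu.2]
  set k := ⌊x + 1 / 2⌋₊ with hk
  have hk1 : (k : ℝ) ≤ x + 1 / 2 := Nat.floor_le (by positivity)
  have hk2 : x + 1 / 2 < k + 1 := Nat.lt_floor_add_one _
  have hkn : k ≤ n + 1 := by
    have : (k : ℝ) < (n + 1 : ℕ) + 1 := by push_cast; linarith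
    exact Nat.lt_succ_iff.1 (by exact_mod_cast this)
  have hind : ∀ (f : ℝ → ℝ), (∀ x, 0 ≤ f x) → ∀ y, 0 ≤ (Icc (-d) d).indicator f y :=
    fun f hf y => indicator_nonneg (fun x _ => hf x) y
  have h1 := fun y => hind (fun x => |x| ^ r) (fun x => by positivity) y
  have h2 := fun y => hind (fun _ => (3 * d) ^ r) (fun x => by positivity) y
  have hsum := Finset.sum_nonneg fun (i : Fin n) (_ : i ∈ Finset.univ) =>
    h1 (u - grid c n ((i : ℝ) + 1))
  rcases Nat.eq_zero_or_pos k with h0 | hpos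
  · have hmem : u - 1 ∈ Icc (-d) d := by
      rw [h0] at hk1 hk2; push_cast at *
      constructor <;> nlinarith
    have hle : |u - grid c n (((⟨0, hn⟩ : Fin n) : ℝ) + 1)| ≤ 3 * d := by
      rw [hgrid]; push_cast
      rw [abs_le]; constructor <;> linarith [hmem.1, hmem.2]
    refine ⟨⟨0, hn⟩, hle, ?_⟩
    have h3 := Real.rpow_le_rpow (abs_nonneg _) hle hr.le
    rw [gridEnvelope, indicator_of_mem hmem]
    linarith [h2 (u - c)]
  rcases hkn.eq_or_lt with hlast | hlt
  · have hmem : u - c ∈ Icc (-d) d := by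
      rw [hlast] at hk1 hk2; push_cast at hk1 hk2
      constructor <;> nlinarith
    have hle : |u - grid c n (((⟨n - 1, by omega⟩ : Fin n) : ℝ) + 1)| ≤ 3 * d := by
      rw [hgrid]
      simp only [Nat.cast_sub (show 1 ≤ n from hn), Nat.cast_one, sub_add_cancel]
      rw [abs_le]; constructor <;> linarith [hmem.1, hmem.2]
    refine ⟨⟨n - 1, by omega⟩, hle, ?_⟩
    have h3 := Real.rpow_le_rpow (abs_nonneg _) hle hr.le
    rw [gridEnvelope, indicator_of_mem hmem]
    linarith [h2 (u - 1)]
  · have hcast : (((⟨k - 1, by omega⟩ : Fin n) : ℝ) + 1) = k := by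
      simp [Nat.cast_sub (show 1 ≤ k from hpos)]
    have hmem : u - grid c n (((⟨k - 1, by omega⟩ : Fin n) : ℝ) + 1) ∈ Icc (-d) d := by
      rw [hcast, hgrid]
      constructor <;> nlinarith
    refine ⟨⟨k - 1, by omega⟩, (abs_le.2 hmem).trans (by linarith), ?_⟩
    have h3 := Finset.single_le_sum (f := fun i : Fin n =>
      (Icc (-d) d).indicator (fun x => |x| ^ r) (u - grid c n ((i : ℝ) + 1)))
      (fun i _ => h1 _) (Finset.mem_univ ⟨k - 1, by omega⟩)
    simp only [] at h3
    rw [indicator_of_mem hmem] at h3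
    rw [gridEnvelope]
    linarith [h2 (u - 1), h2 (u - c)]

lemma integral_abs_benford_sub_quant_le {b r : ℝ} (hb : 1 < b) (hr : 0 < r) {n : ℕ} (hn : 0 < n)
    {d : ℝ} (hd : d = (b ^ (r / (r + 1)) - 1) / (2 * ((n : ℝ) + 1))) :
    ∫ t in Ioo (0 : ℝ) 1, |quant (benford b) 1 b t -
      quant (discr n (benfordAsympX b r n) (benfordAsympW b r n)) 1 b t| ^ r ≤
    (Real.log (b ^ (r / (r + 1))))⁻¹ * ((1 + 1 / r) ^ r * (1 + 3 * d) *
      (n * (2 * (d ^ (r + 1) / (r + 1))) + 4 * d * (3 * d) ^ r)) := by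
  have hpow := rpow_rpow_exponents hr (zero_le_one.trans hb.le)
  have hX := benfordAsympX_eq b r n
  have hc : 1 < b ^ (r / (r + 1)) := Real.one_lt_rpow hb (by positivity)
  have hd0 : 0 < d := by rw [hd]; exact div_pos (by linarith) (by positivity)
  generalize b ^ (r / (r + 1)) = c at *
  have hE := gridEnvelope_integrable (c := c) (d := d) hr n
  set K := (1 + 1 / r) ^ r * (1 + 3 * d) with hK
  have hK0 : 0 < K := by positivity
  set G : ℝ → ℝ := fun u => K * gridEnvelope c r d n u with hG
  have hGi : Integrable G := hE.const_mul K
  calc _ ≤ ∫ t in Ioo (0 : ℝ) 1, c ^ t * G (c ^ t) := by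
        refine integral_mono_of_nonneg (ae_of_all _ fun t => by positivity)
          (integrableOn_mul_comp_rpow hc hGi.integrableOn)
          ((ae_restrict_iff' measurableSet_Ioo).2 (ae_of_all _ fun t ht => ?_))
        have hu : c ^ t ∈ Icc 1 c := ⟨Real.one_le_rpow hc.le ht.1.le,
          by simpa using Real.rpow_le_rpow_of_exponent_le hc.le ht.2.le⟩
        obtain ⟨i, hi1, hi2⟩ := exists_rpow_le_gridEnvelope hc hr hn hd hu
        simp only [quant_benford hb ht]
        refine (Real.rpow_le_rpow (abs_nonneg _)
          (abs_sub_quant_benfordAsymp_le hb hr ht i) hr.le).trans ?_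
        rw [hX i, ← hpow t]
        refine (abs_sub_rpow_le_mul_one_add hr hu.1
          (one_le_grid hc.le n (by positivity)) hi1).trans ?_
        have := hu.1
        simp only [hG]
        gcongr
    _ = (Real.log c)⁻¹ * ∫ u in Ioo 1 c, G u := integral_Ioo_mul_comp_rpow hc G
    _ ≤ (Real.log c)⁻¹ * ∫ u, G u :=
        mul_le_mul_of_nonneg_left (setIntegral_le_integral hGi (ae_of_all _ fun u =>
          mul_nonneg hK0.le (gridEnvelope_nonneg hd0.le n u))) (inv_nonneg.2 (Real.log_pos hc).le)
    _ = _ := by rw [hG, integral_const_mul, integral_gridEnvelope hr hd0.le]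

lemma mul_dKant_eq {r b : ℝ} (hr : 0 < r) (n : ℕ) (μ ν : Measure ℝ) :
    (n : ℝ) * dKant 1 b r μ ν = (b - 1)⁻¹ *
      ((n : ℝ) ^ r * ∫ t in Ioo (0 : ℝ) 1, |quant μ 1 b t - quant ν 1 b t| ^ r) ^ (1 / r) := by
  have hI : 0 ≤ ∫ t in Ioo (0 : ℝ) 1, |quant μ 1 b t - quant ν 1 b t| ^ r :=
    integral_nonneg fun t => by positivity
  rw [dKant, Real.mul_rpow (by positivity) hI, ← Real.rpow_mul (by positivity),
    mul_one_div_cancel hr.ne', Real.rpow_one]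
  ring

lemma quantization_const_eq {b r : ℝ} (hb : 1 < b) (hr : 0 < r) :
    (b - 1)⁻¹ * ((Real.log (b ^ (r / (r + 1))))⁻¹ * ((1 + 1 / r) ^ r *
      (2 * (((b ^ (r / (r + 1)) - 1) / 2) ^ (r + 1) / (r + 1))))) ^ (1 / r) =
    (r + 1) / (2 * (b - 1) * Real.log b ^ (1 / r)) *
        ((b ^ (r / (r + 1)) - 1) / r) ^ (1 + 1 / r) := by
  have hL : 0 < b ^ (r / (r + 1)) - 1 := sub_pos.2 (Real.one_lt_rpow hb (by positivity))
  have hlog := Real.log_pos hb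
  rw [Real.log_rpow (by linarith)]
  generalize b ^ (r / (r + 1)) - 1 = L at *
  have hb1 : 0 < b - 1 := by linarith
  have key : (r / (r + 1) * Real.log b)⁻¹ * ((1 + 1 / r) ^ r * (2 * ((L / 2) ^ (r + 1) / (r + 1))))
      = ((r + 1) / 2) ^ r * (L / r) ^ (r + 1) / Real.log b := by
    have e : (1 + 1 / r) = (r + 1) / r := by field_simp
    rw [e, Real.rpow_add_one (by positivity), Real.rpow_add_one (by positivity),
      Real.div_rpow (by positivity) hr.le, Real.div_rpow hL.le (by positivity),
      Real.div_rpow hL.le hr.le, Real.div_rpow (by positivity) (by positivity)]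
    field_simp
  rw [key, Real.div_rpow (by positivity) hlog.le, Real.mul_rpow (by positivity) (by positivity),
    ← Real.rpow_mul (by positivity), ← Real.rpow_mul (by positivity), mul_one_div_cancel hr.ne',
    Real.rpow_one]
  have e : (r + 1) * (1 / r) = 1 + 1 / r := by field_simp
  rw [e]
  field_simp

lemma tendsto_lower_quantization_bound (L c r : ℝ) :
    Tendsto (fun n : ℕ => (Real.log c)⁻¹ * ((1 + 1 / r) ^ r * ((L / 2) ^ r * (L -
      L * (r / (r + 1)) * (1 - L / (2 * (n : ℝ)) * c) ^ (-(1 / r)))))) atTop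
      (nhds ((Real.log c)⁻¹ * ((1 + 1 / r) ^ r * ((L / 2) ^ r * (L - L * (r / (r + 1))))))) := by
  have h0 : Tendsto (fun n : ℕ => L / (2 * (n : ℝ))) atTop (nhds 0) :=
    tendsto_const_nhds.div_atTop (tendsto_natCast_atTop_atTop.const_mul_atTop two_pos)
  have h1 : Tendsto (fun n : ℕ => (1 - L / (2 * (n : ℝ)) * c) ^ (-(1 / r))) atTop (nhds 1) := by
    have := ((h0.mul_const c).const_sub 1).rpow_const (p := -(1 / r)) (Or.inl (by simp))
    simpa using this
  have := ((((h1.const_mul (L * (r / (r + 1)))).const_sub L).const_mul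
    ((L / 2) ^ r)).const_mul ((1 + 1 / r) ^ r)).const_mul (Real.log c)⁻¹
  simpa only [mul_one] using this

lemma tendsto_upper_quantization_bound {L c r : ℝ} (hr : 0 < r) (hL : 0 < L) :
    Tendsto (fun n : ℕ => (n : ℝ) ^ r * ((Real.log c)⁻¹ * ((1 + 1 / r) ^ r *
      (1 + 3 * (L / (2 * ((n : ℝ) + 1)))) *
      (n * (2 * ((L / (2 * ((n : ℝ) + 1))) ^ (r + 1) / (r + 1))) +
        4 * (L / (2 * ((n : ℝ) + 1))) * (3 * (L / (2 * ((n : ℝ) + 1)))) ^ r)))) atTop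
      (nhds ((Real.log c)⁻¹ * ((1 + 1 / r) ^ r * (2 * ((L / 2) ^ (r + 1) / (r + 1)))))) := by
  have h0 : Tendsto (fun n : ℕ => L / (2 * ((n : ℝ) + 1))) atTop (nhds 0) :=
    tendsto_const_nhds.div_atTop ((tendsto_atTop_add_const_right _ _
      tendsto_natCast_atTop_atTop).const_mul_atTop two_pos)
  have h1 : Tendsto (fun n : ℕ => (n : ℝ) * (L / (2 * ((n : ℝ) + 1)))) atTop (nhds (L / 2)) := by
    have h := (tendsto_natCast_div_add_atTop (1 : ℝ)).const_mul (L / 2)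
    rw [mul_one] at h
    refine h.congr fun n => ?_
    have : (n : ℝ) + 1 ≠ 0 := by positivity
    field_simp
  have h2 := h1.rpow_const (p := r + 1) (Or.inr (by linarith))
  have h3 := h1.rpow_const (p := r) (Or.inr hr.le)
  have := ((((h0.const_mul 3).const_add 1).const_mul ((1 + 1 / r) ^ r)).mul
    (((h2.div_const (r + 1)).const_mul 2).add ((h0.mul h3).const_mul (4 * 3 ^ r)))).const_mul
    (Real.log c)⁻¹
  simp only [mul_zero, zero_mul, add_zero, mul_one] at this
  refine this.congr' ?_
  filter_upwards [eventually_gt_atTop 0] with n hn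
  have hn' : (0 : ℝ) < n := by exact_mod_cast hn
  have hd : 0 < L / (2 * ((n : ℝ) + 1)) := by positivity
  generalize L / (2 * ((n : ℝ) + 1)) = d at *
  rw [Real.mul_rpow hn'.le hd.le, Real.mul_rpow hn'.le hd.le, Real.mul_rpow (by norm_num) hd.le,
    Real.rpow_add_one hn'.ne']
  ring

/-- Prop. 4.7: the explicit measures `δ_{x_n}^{p_n}` are asymptotically
best `d_r`-approximations of the Benford measure `β_b`, and the `d_r`-quantization
coefficient of `β_b`. -/
theorem asymp_best_dKant_benford (b r : ℝ) (hb : 1 < b) (hr : 1 < r) :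
    Filter.Tendsto
      (fun n : ℕ =>
        dKant 1 b r (benford b) (discr n (benfordAsympX b r n) (benfordAsympW b r n)) /
          sInf {c : ℝ | ∃ y q : Fin n → ℝ, IsXi 1 b n y ∧ IsPi n q ∧
            c = dKant 1 b r (benford b) (discr n y q)})
      Filter.atTop (nhds 1) ∧
    Filter.Tendsto
      (fun n : ℕ => (n : ℝ) * sInf {c : ℝ | ∃ y q : Fin n → ℝ, IsXi 1 b n y ∧ IsPi n q ∧
        c = dKant 1 b r (benford b) (discr n y q)})
      Filter.atTop
      (nhds ((r + 1) / (2 * (b - 1) * Real.log b ^ (1 / r)) *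
        ((b ^ (r / (r + 1)) - 1) / r) ^ (1 + 1 / r))) := by
  have hr0 : 0 < r := by linarith
  have hL : 0 < b ^ (r / (r + 1)) - 1 := sub_pos.2 (Real.one_lt_rpow hb (by positivity))
  have hb1 : 0 < b - 1 := by linarith
  have hlc : 0 < Real.log (b ^ (r / (r + 1))) := Real.log_pos (by linarith)
  set L := b ^ (r / (r + 1)) - 1 with hLdef
  set S : ℕ → ℝ := fun n => sInf {c : ℝ | ∃ y q : Fin n → ℝ, IsXi 1 b n y ∧ IsPi n q ∧
    c = dKant 1 b r (benford b) (discr n y q)} with hS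
  set D : ℕ → ℝ := fun n =>
    dKant 1 b r (benford b) (discr n (benfordAsympX b r n) (benfordAsympW b r n)) with hD
  set Q := (Real.log (b ^ (r / (r + 1))))⁻¹ * ((1 + 1 / r) ^ r *
    (2 * ((L / 2) ^ (r + 1) / (r + 1)))) with hQ
  have hQ0 : 0 < Q := by positivity
  rw [← quantization_const_eq hb hr0]
  have hSD : ∀ᶠ n : ℕ in atTop, (n : ℝ) * S n ≤ n * D n := by
    filter_upwards [eventually_gt_atTop 0] with n hn
    refine mul_le_mul_of_nonneg_left (csInf_le ⟨0, ?_⟩ ?_) (by positivity)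
    · rintro _ ⟨y, q, -, -, rfl⟩
      exact mul_nonneg (inv_nonneg.2 hb1.le)
        (Real.rpow_nonneg (integral_nonneg fun t => by positivity) _)
    · exact ⟨_, _, isXi_benfordAsympX hb hr0 n, isPi_benfordAsympW hb hr0 hn, rfl⟩
  have hup := (((tendsto_upper_quantization_bound (c := b ^ (r / (r + 1))) hr0 hL).rpow_const (p := 1 / r)
    (Or.inl hQ0.ne')).const_mul (b - 1)⁻¹)
  have hDle : ∀ᶠ n : ℕ in atTop, (n : ℝ) * D n ≤ (b - 1)⁻¹ * ((n : ℝ) ^ r *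
      ((Real.log (b ^ (r / (r + 1))))⁻¹ * ((1 + 1 / r) ^ r *
      (1 + 3 * (L / (2 * ((n : ℝ) + 1)))) *
      (n * (2 * ((L / (2 * ((n : ℝ) + 1))) ^ (r + 1) / (r + 1))) +
        4 * (L / (2 * ((n : ℝ) + 1))) * (3 * (L / (2 * ((n : ℝ) + 1)))) ^ r)))) ^ (1 / r) := by
    filter_upwards [eventually_gt_atTop 0] with n hn
    rw [hD, mul_dKant_eq hr0]
    refine mul_le_mul_of_nonneg_left (Real.rpow_le_rpow (mul_nonneg (by positivity)
      (integral_nonneg fun t => by positivity)) ?_ (by positivity)) (inv_nonneg.2 hb1.le)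
    exact mul_le_mul_of_nonneg_left (integral_abs_benford_sub_quant_le hb hr0 hn rfl)
      (by positivity)
  have hlim := tendsto_lower_quantization_bound L (b ^ (r / (r + 1))) r
  have hQeq : (Real.log (b ^ (r / (r + 1))))⁻¹ * ((1 + 1 / r) ^ r * ((L / 2) ^ r *
      (L - L * (r / (r + 1))))) = Q := by
    rw [hQ, Real.rpow_add_one (by positivity)]
    field_simp; ring
  rw [hQeq] at hlim
  have hlow := (hlim.rpow_const (p := 1 / r) (Or.inl hQ0.ne')).const_mul (b - 1)⁻¹
  have hSge : ∀ᶠ n : ℕ in atTop, (b - 1)⁻¹ * ((Real.log (b ^ (r / (r + 1))))⁻¹ *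
      ((1 + 1 / r) ^ r * ((L / 2) ^ r * (L - L * (r / (r + 1)) *
        (1 - L / (2 * (n : ℝ)) * b ^ (r / (r + 1))) ^ (-(1 / r)))))) ^ (1 / r) ≤ n * S n := by
    have h0 : Tendsto (fun n : ℕ => 1 - L / (2 * (n : ℝ)) * b ^ (r / (r + 1))) atTop
        (nhds (1 - 0 * b ^ (r / (r + 1)))) :=
      ((tendsto_const_nhds.div_atTop
        (tendsto_natCast_atTop_atTop.const_mul_atTop two_pos)).mul_const _).const_sub 1
    filter_upwards [eventually_gt_atTop 0, h0.eventually_const_lt (by simp : (0 : ℝ) < _),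
      hlim.eventually_const_lt hQ0] with n hn hθ hpos
    have hn' : (0 : ℝ) < n := by exact_mod_cast hn
    rw [mul_comm (n : ℝ), ← div_le_iff₀ hn']
    refine le_csInf ⟨_, _, _, isXi_benfordAsympX hb hr0 n, isPi_benfordAsympW hb hr0 hn, rfl⟩ ?_
    rintro _ ⟨y, q, hy, hq, rfl⟩
    rw [div_le_iff₀ hn', mul_comm (dKant _ _ _ _ _) (n : ℝ), mul_dKant_eq hr0]
    refine mul_le_mul_of_nonneg_left (Real.rpow_le_rpow hpos.le ?_ (by positivity))
      (inv_nonneg.2 hb1.le)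
    have hT : 0 < L / (2 * (n : ℝ)) := by positivity
    refine le_trans (le_of_eq ?_) (mul_le_mul_of_nonneg_left
      (sub_le_integral_abs_benford_sub_quant hb hr hy hq hT hθ) (by positivity : 0 ≤ (n : ℝ) ^ r))
    have hnT : L / 2 = n * (L / (2 * (n : ℝ))) := by field_simp
    rw [← hLdef, hnT, Real.mul_rpow hn'.le hT.le, Real.rpow_add_one hT.ne']
    generalize (1 - L / (2 * (n : ℝ)) * b ^ (r / (r + 1))) ^ (-(1 / r)) = z
    generalize (L / (2 * (n : ℝ))) ^ r = w
    field_simp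
  have hSlim := tendsto_of_tendsto_of_tendsto_of_le_of_le' hlow hup hSge
    (hSD.and hDle |>.mono fun n h => h.1.trans h.2)
  have hDlim := tendsto_of_tendsto_of_tendsto_of_le_of_le' hlow hup
    (hSge.and hSD |>.mono fun n h => h.1.trans h.2) hDle
  refine ⟨?_, hSlim⟩
  have hC : (b - 1)⁻¹ * Q ^ (1 / r) ≠ 0 := by positivity
  have h := hDlim.div hSlim hC
  rw [div_self hC] at h
  refine h.congr' ?_
  filter_upwards [eventually_gt_atTop 0] with n hn
  exact mul_div_mul_left _ _ (by exact_mod_cast hn.ne')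

end BenfordApprox
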